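/- Let C ∈ ℂ^{s×s} be invertible and let γ, q ∈ ℂ with γq ≠ 1. Set θ = (1−γq)⁻¹ (a scalar) and M(q) = θ·(I_s − qC) + (1−θ)·γ·(C⁻¹ − qI_s). Then the blended iteration matrix satisfies the identity Z(q) := I_s − θ·M(q) = (q/(1−γq)²)·C⁻¹·(C − γI_s)². In particular Z(0) = 0, and Z(q) → 0 as |q| → ∞ when γ ≠ 0. -/

import Mathlib

open Matrix

/-- The blended iteration matrix `Z(q) = I − θ M(q)`, where `θ = (1−γq)⁻¹` and
`M(q) = θ (I − qC) + (1−θ) γ (C⁻¹ − q I)`. -/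
noncomputable def blendedZ {s : ℕ} (C : Matrix (Fin s) (Fin s) ℂ) (γ q : ℂ) :
    Matrix (Fin s) (Fin s) ℂ :=
  1 - (1 - γ * q)⁻¹ •
    ((1 - γ * q)⁻¹ • ((1 : Matrix (Fin s) (Fin s) ℂ) - q • C)
      + ((1 - (1 - γ * q)⁻¹) * γ) • (C⁻¹ - q • (1 : Matrix (Fin s) (Fin s) ℂ)))

/-- The closed form of the blended iteration matrix. -/
theorem blendedZ_eq_smul {s : ℕ} (C : Matrix (Fin s) (Fin s) ℂ) (hC : IsUnit C.det)
    (γ q : ℂ) (hq : γ * q ≠ 1) :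
    blendedZ C γ q
      = (q / (1 - γ * q) ^ 2) • (C⁻¹ * (C - γ • (1 : Matrix (Fin s) (Fin s) ℂ)) ^ 2) := by
  have hd : 1 - γ * q ≠ 0 := sub_ne_zero.mpr hq.symm
  have hinv : C⁻¹ * C = 1 := nonsing_inv_mul C hC
  have hsq : C⁻¹ * (C - γ • (1 : Matrix (Fin s) (Fin s) ℂ)) ^ 2
      = C - (2 * γ) • (1 : Matrix (Fin s) (Fin s) ℂ) + γ ^ 2 • C⁻¹ := by
    simp only [pow_two, ← mul_assoc, mul_sub, sub_mul, hinv, mul_smul_comm, smul_mul_assoc,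
      mul_one, one_mul]
    module
  rw [hsq, blendedZ]
  match_scalars <;> field_simp <;> ring

/-- For `γ ≠ 0`, the scalar `q / (1 - γ q)²` vanishes at infinity. -/
theorem tendsto_div_one_sub_mul_sq_cobounded {γ : ℂ} (hγ : γ ≠ 0) :
    Filter.Tendsto (fun z : ℂ => z / (1 - γ * z) ^ 2) (Bornology.cobounded ℂ) (nhds 0) := by
  have hinv : Filter.Tendsto (fun z : ℂ => z⁻¹) (Bornology.cobounded ℂ) (nhds 0) :=
    Filter.tendsto_inv₀_cobounded
  have hlim : Filter.Tendsto (fun z : ℂ => z⁻¹ / (z⁻¹ - γ) ^ 2)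
      (Bornology.cobounded ℂ) (nhds (0 / (0 - γ) ^ 2)) :=
    hinv.div ((hinv.sub_const γ).pow 2) (by simpa using hγ)
  rw [zero_div] at hlim
  refine hlim.congr' ?_
  filter_upwards [Bornology.eventually_ne_cobounded (0 : ℂ)] with z hz
  rw [show z⁻¹ - γ = (1 - γ * z) / z by field_simp]
  field_simp

/-- For invertible `C` and `γ q ≠ 1`, the blended iteration matrix satisfies
`Z(q) = (q/(1−γq)²) C⁻¹ (C − γ I)²`; in particular `Z(0) = 0` and, when `γ ≠ 0`,
`Z(q) → 0` as `|q| → ∞`. -/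
theorem blendedZ_formula
    {s : ℕ} (C : Matrix (Fin s) (Fin s) ℂ) (hC : IsUnit C.det)
    (γ q : ℂ) (hq : γ * q ≠ 1) :
    blendedZ C γ q
        = (q / (1 - γ * q) ^ 2) • (C⁻¹ * (C - γ • (1 : Matrix (Fin s) (Fin s) ℂ)) ^ 2) ∧
    blendedZ C γ 0 = 0 ∧
    (γ ≠ 0 → Filter.Tendsto (fun z : ℂ => blendedZ C γ z)
      (Bornology.cobounded ℂ) (nhds 0)) := by
  refine ⟨blendedZ_eq_smul C hC γ q hq, by simp [blendedZ], fun hγ => ?_⟩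
  have hlim := (tendsto_div_one_sub_mul_sq_cobounded hγ).smul_const
    (C⁻¹ * (C - γ • (1 : Matrix (Fin s) (Fin s) ℂ)) ^ 2)
  rw [zero_smul] at hlim
  refine hlim.congr' ?_
  filter_upwards [Bornology.eventually_ne_cobounded γ⁻¹] with z hz
  exact (blendedZ_eq_smul C hC γ z fun h => hz (eq_inv_of_mul_eq_one_right h)).symm
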